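/- Let b ∈ C¹_♯(Y_d)^d with flow X, and let ζ ∈ ℝ^d. Then Herman's rotation set C_b equals the singleton {ζ} if and only if for every x ∈ ℝ^d the quotient X(t,x)/t converges to ζ as t → ∞. -/

import Mathlib

open MeasureTheory Filter Matrix

noncomputable section

/-- A function on `ℝ^d` is `ℤ^d`-periodic. -/
def ZdPeriodic {d : ℕ} {E : Type*} (f : (Fin d → ℝ) → E) : Prop :=
  ∀ (κ : Fin d → ℤ) (x : Fin d → ℝ), f (x + fun i => (κ i : ℝ)) = f x

/-- The unit cube `[0,1)^d`, a fundamental domain for the torus `Y_d = ℝ^d/ℤ^d`. -/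
def unitCube (d : ℕ) : Set (Fin d → ℝ) := {x | ∀ i, x i ∈ Set.Ico (0 : ℝ) 1}

/-- `X` is the global flow of the vector field `b`: `∂X/∂t(t,x) = b(X(t,x))`, `X(0,x) = x`. -/
def IsFlowOf {d : ℕ} (b : (Fin d → ℝ) → (Fin d → ℝ))
    (X : ℝ → (Fin d → ℝ) → (Fin d → ℝ)) : Prop :=
  ∀ x : Fin d → ℝ, X 0 x = x ∧ ∀ t : ℝ, HasDerivAt (fun s => X s x) (b (X t x)) t

/-- A measure `μ` on the torus `Y_d` (identified with a measure on `ℝ^d` carried by the unit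
cube) is invariant for the flow `X`: `∫ ψ(X(t,y)) dμ = ∫ ψ dμ` for all `t` and all continuous
`ℤ^d`-periodic `ψ`. -/
def FlowInvariant {d : ℕ} (X : ℝ → (Fin d → ℝ) → (Fin d → ℝ))
    (μ : Measure (Fin d → ℝ)) : Prop :=
  ∀ (t : ℝ) (ψ : (Fin d → ℝ) → ℝ), Continuous ψ → ZdPeriodic ψ →
    ∫ y, ψ (X t y) ∂μ = ∫ y, ψ y ∂μ

/-- Herman's rotation set `C_b = {∫ b dμ : μ invariant probability measure for the flow}`. -/
def rotationSet {d : ℕ} (b : (Fin d → ℝ) → (Fin d → ℝ))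
    (X : ℝ → (Fin d → ℝ) → (Fin d → ℝ)) : Set (Fin d → ℝ) :=
  {ζ | ∃ μ : Measure (Fin d → ℝ), IsProbabilityMeasure μ ∧ μ (unitCube d)ᶜ = 0 ∧
        FlowInvariant X μ ∧ ζ = ∫ y, b y ∂μ}

/-- The gradient of a scalar function on `ℝ^d`. -/
def grad {d : ℕ} (ψ : (Fin d → ℝ) → ℝ) (y : Fin d → ℝ) : Fin d → ℝ :=
  fun i => fderiv ℝ ψ y (Pi.single i 1)

open Set Topology

section PeriodicFunctions

variable {d : ℕ}

lemma ZdPeriodic.apply_fract {E : Type*} {f : (Fin d → ℝ) → E} (hf : ZdPeriodic f)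
    (x : Fin d → ℝ) : f (fun i => Int.fract (x i)) = f x := by
  have h := hf (fun i => ⌊x i⌋) (fun i => Int.fract (x i))
  rw [← h]
  congr 1
  ext i
  exact Int.fract_add_floor (x i)

lemma ZdPeriodic.exists_norm_le {E : Type*} [SeminormedAddCommGroup E] {f : (Fin d → ℝ) → E}
    (hf : ZdPeriodic f) (hc : Continuous f) : ∃ C, ∀ x, ‖f x‖ ≤ C := by
  obtain ⟨C, hC⟩ := (isCompact_Icc (a := (0 : Fin d → ℝ)) (b := 1)).exists_bound_of_continuousOn
    hc.continuousOn
  refine ⟨C, fun x => ?_⟩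
  rw [← hf.apply_fract x]
  exact hC _ ⟨fun i => Int.fract_nonneg _, fun i => (Int.fract_lt_one _).le⟩

lemma ZdPeriodic.exists_lipschitzWith {E : Type*} [NormedAddCommGroup E] [NormedSpace ℝ E]
    {f : (Fin d → ℝ) → E} (hf : ZdPeriodic f) (hc : ContDiff ℝ 1 f) :
    ∃ K, LipschitzWith K f := by
  have hper : ZdPeriodic (fderiv ℝ f) := by
    intro κ x
    rw [← fderiv_comp_add_right]
    congr 1
    ext1 y
    exact hf κ y
  obtain ⟨C, hC⟩ := hper.exists_norm_le (hc.continuous_fderiv one_ne_zero)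
  have hC0 : 0 ≤ C := (norm_nonneg _).trans (hC 0)
  exact ⟨⟨C, hC0⟩, lipschitzWith_of_nnnorm_fderiv_le (hc.differentiable one_ne_zero)
    fun x => hC x⟩

end PeriodicFunctions

section Flow

variable {d : ℕ} {b : (Fin d → ℝ) → (Fin d → ℝ)} {X : ℝ → (Fin d → ℝ) → (Fin d → ℝ)}
  {K : NNReal}

lemma IsFlowOf.continuous_orbit (hX : IsFlowOf b X) (x : Fin d → ℝ) :
    Continuous fun t => X t x :=
  continuous_iff_continuousAt.2 fun t => ((hX x).2 t).continuousAt

lemma IsFlowOf.eq_of_hasDerivAt (hX : IsFlowOf b X) (hb : LipschitzWith K b)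
    {γ : ℝ → Fin d → ℝ} (hγ : ∀ t, HasDerivAt γ (b (γ t)) t) (t : ℝ) : γ t = X t (γ 0) := by
  refine congrFun (ODE_solution_unique_univ (v := fun _ => b) (s := fun _ => univ) (K := K)
    (t₀ := 0) (fun _ => hb.lipschitzOnWith) (fun t => ⟨hγ t, mem_univ _⟩)
    (fun t => ⟨(hX (γ 0)).2 t, mem_univ _⟩) (hX (γ 0)).1.symm) t

lemma IsFlowOf.apply_add (hX : IsFlowOf b X) (hb : LipschitzWith K b) (s t : ℝ)
    (x : Fin d → ℝ) : X (s + t) x = X s (X t x) := by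
  have h := hX.eq_of_hasDerivAt hb (γ := fun r => X (r + t) x)
    (fun r => ((hX x).2 (r + t)).comp_add_const r t) s
  simpa using h

lemma IsFlowOf.apply_add_int (hX : IsFlowOf b X) (hb : LipschitzWith K b) (hper : ZdPeriodic b)
    (t : ℝ) (κ : Fin d → ℤ) (x : Fin d → ℝ) :
    X t (x + fun i => (κ i : ℝ)) = X t x + fun i => (κ i : ℝ) := by
  have h := hX.eq_of_hasDerivAt hb (γ := fun r => X r x + fun i => (κ i : ℝ))
    (fun r => by rw [hper κ]; exact ((hX x).2 r).add_const _) t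
  simpa only [(hX x).1] using h.symm

lemma IsFlowOf.neg (hX : IsFlowOf b X) : IsFlowOf (-b) fun t => X (-t) := by
  refine fun x => ⟨by simpa using (hX x).1, fun t => ?_⟩
  have h := ((hX x).2 (-t)).scomp t (hasDerivAt_neg t)
  rw [neg_one_smul] at h
  exact h

lemma IsFlowOf.continuous_of_nonneg (hX : IsFlowOf b X) (hb : LipschitzWith K b) {t : ℝ}
    (ht : 0 ≤ t) : Continuous (X t) := by
  refine (LipschitzWith.of_dist_le_mul (K := ⟨Real.exp (K * t), (Real.exp_pos _).le⟩)
    fun x y => ?_).continuous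
  have h := dist_le_of_trajectories_ODE (v := fun _ => b) (f := fun s => X s x)
    (g := fun s => X s y) (a := 0) (b := t) (δ := dist x y) (fun _ => hb)
    (hX.continuous_orbit x).continuousOn (fun s _ => ((hX x).2 s).hasDerivWithinAt)
    (hX.continuous_orbit y).continuousOn (fun s _ => ((hX y).2 s).hasDerivWithinAt)
    (by rw [(hX x).1, (hX y).1]) t ⟨ht, le_rfl⟩
  rwa [sub_zero, mul_comm] at h

lemma IsFlowOf.continuous (hX : IsFlowOf b X) (hb : LipschitzWith K b) (t : ℝ) :
    Continuous (X t) := by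
  rcases le_total 0 t with ht | ht
  · exact hX.continuous_of_nonneg hb ht
  · simpa using hX.neg.continuous_of_nonneg hb.neg (neg_nonneg.2 ht)

lemma IsFlowOf.zdPeriodic_comp (hX : IsFlowOf b X) (hb : LipschitzWith K b)
    (hper : ZdPeriodic b) {E : Type*} {ψ : (Fin d → ℝ) → E} (hψ : ZdPeriodic ψ) (t : ℝ) :
    ZdPeriodic fun x => ψ (X t x) := by
  intro κ x
  simp only [hX.apply_add_int hb hper t κ x, hψ κ]

lemma IsFlowOf.zdPeriodic_displacement (hX : IsFlowOf b X) (hb : LipschitzWith K b)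
    (hper : ZdPeriodic b) (t : ℝ) : ZdPeriodic fun x => X t x - x := by
  intro κ x
  simp only [hX.apply_add_int hb hper t κ x, add_sub_add_right_eq_sub]

lemma IsFlowOf.integral_apply (hX : IsFlowOf b X) (hb : Continuous b) (x : Fin d → ℝ) (i : Fin d)
    (T : ℝ) : ∫ s in 0..T, b (X s x) i = X T x i - x i := by
  have hderiv : ∀ s ∈ uIcc 0 T, HasDerivAt (fun s => X s x i) (b (X s x) i) s :=
    fun s _ => hasDerivAt_pi.1 ((hX x).2 s) i
  rw [intervalIntegral.integral_eq_sub_of_hasDerivAt hderiv, (hX x).1]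
  have := hX.continuous_orbit x
  exact Continuous.intervalIntegrable (by fun_prop) _ _

lemma IsFlowOf.norm_displacement_le (hX : IsFlowOf b X) {C : ℝ} (hC : ∀ x, ‖b x‖ ≤ C) (t : ℝ)
    (x : Fin d → ℝ) : ‖X t x - x‖ ≤ C * |t| := by
  have h := convex_univ.norm_image_sub_le_of_norm_hasDerivWithin_le (f := fun s => X s x)
    (f' := fun s => b (X s x)) (x := 0) (y := t)
    (fun s _ => ((hX x).2 s).hasDerivWithinAt) (fun s _ => hC _) (mem_univ _) (mem_univ _)
  simpa [(hX x).1] using h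

end Flow

section TimeAverages

variable {d : ℕ}

/-- Along any ultrafilter of times, the occupation measures of a continuous curve on the torus
converge to a probability measure. -/
lemma exists_limit_occupationMeasure {γ : ℝ → Fin d → ℝ} (hγ : Continuous γ) (U : Ultrafilter ℝ)
    (hU : ↑U ≤ (atTop : Filter ℝ)) :
    ∃ ν : Measure (Fin d → ℝ), IsProbabilityMeasure ν ∧ ν (unitCube d)ᶜ = 0 ∧
      ∀ ψ : (Fin d → ℝ) → ℝ, Continuous ψ → ZdPeriodic ψ →
        Tendsto (fun T => T⁻¹ * ∫ s in 0..T, ψ (γ s)) U (𝓝 (∫ y, ψ y ∂ν)) := by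
  let fr : (Fin d → ℝ) → Fin d → ℝ := fun x i => Int.fract (x i)
  have hfr : Measurable fr := measurable_pi_lambda _ fun i => (measurable_pi_apply i).fract
  let p : (Fin d → ℝ) → Icc (0 : Fin d → ℝ) 1 := fun x =>
    ⟨fr x, fun i => Int.fract_nonneg _, fun i => (Int.fract_lt_one _).le⟩
  have hp : Measurable p := hfr.subtype_mk
  let lam : Measure ℝ := volume.restrict (Ioc 0 1)
  have hlam : IsProbabilityMeasure lam := ⟨by simp [lam]⟩
  have hpγ (T : ℝ) : Measurable fun s => p (γ (T * s)) :=
    hp.comp (hγ.comp (continuous_const_mul T)).measurable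
  let m : ℝ → ProbabilityMeasure (Icc (0 : Fin d → ℝ) 1) := fun T =>
    ⟨lam.map fun s => p (γ (T * s)), Measure.isProbabilityMeasure_map (hpγ T).aemeasurable⟩
  have hm : Tendsto m U (𝓝 (U.map m).lim) := (U.map m).le_nhds_lim
  set μ := (U.map m).lim
  have hmeas : Measurable fun z : Icc (0 : Fin d → ℝ) 1 => fr z := hfr.comp measurable_subtype_coe
  refine ⟨(μ : Measure (Icc (0 : Fin d → ℝ) 1)).map fun z : Icc (0 : Fin d → ℝ) 1 => fr z,
    Measure.isProbabilityMeasure_map hmeas.aemeasurable, ?_, fun ψ hψ hper => ?_⟩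
  · have hcube : MeasurableSet (unitCube d) := by
      have : unitCube d = univ.pi fun _ => Ico (0 : ℝ) 1 := by ext; simp [unitCube]
      rw [this]
      exact MeasurableSet.univ_pi fun _ => measurableSet_Ico
    rw [Measure.map_apply hmeas hcube.compl]
    convert measure_empty (μ := (μ : Measure (Icc (0 : Fin d → ℝ) 1)))
    ext z
    simpa using show fr z ∈ unitCube d from fun i => ⟨Int.fract_nonneg _, Int.fract_lt_one _⟩
  · rw [integral_map hmeas.aemeasurable hψ.aestronglyMeasurable]
    simp only [fr, hper.apply_fract]
    let g : BoundedContinuousFunction (Icc (0 : Fin d → ℝ) 1) ℝ :=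
      BoundedContinuousFunction.mkOfCompact ⟨fun z => ψ z, hψ.comp continuous_subtype_val⟩
    have hlim := ProbabilityMeasure.tendsto_iff_forall_integral_tendsto.1 hm g
    refine hlim.congr' ?_
    filter_upwards [hU (eventually_ne_atTop 0)] with T hT
    have h1 : ∫ z, g z ∂(m T : Measure _) = ∫ s, g (p (γ (T * s))) ∂lam :=
      integral_map (hpγ T).aemeasurable g.continuous.aestronglyMeasurable
    have h2 (x : Fin d → ℝ) : g (p x) = ψ x := hper.apply_fract x
    rw [h1]
    simp only [h2, lam]
    rw [← intervalIntegral.integral_of_le zero_le_one,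
      intervalIntegral.integral_comp_mul_left (fun s => ψ (γ s)) hT]
    simp

/-- Long time averages of a bounded continuous function do not feel a shift of time. -/
lemma tendsto_average_shift_sub {f : ℝ → ℝ} (hf : Continuous f) {C : ℝ} (hC : ∀ s, ‖f s‖ ≤ C)
    (t : ℝ) :
    Tendsto (fun T => (T⁻¹ * ∫ s in 0..T, f (s + t)) - T⁻¹ * ∫ s in 0..T, f s) atTop (𝓝 0) := by
  have hi (a c : ℝ) : IntervalIntegrable f volume a c := hf.intervalIntegrable _ _
  have hbound : ∀ T, ‖(∫ s in 0..T, f (s + t)) - ∫ s in 0..T, f s‖ ≤ C * |t| + C * |t| := by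
    intro T
    rw [intervalIntegral.integral_comp_add_right, zero_add,
      intervalIntegral.integral_interval_sub_interval_comm (hi _ _) (hi _ _) (hi _ _)]
    have h1 := intervalIntegral.norm_integral_le_of_norm_le_const (a := t) (b := 0)
      (fun s _ => hC s)
    have h2 := intervalIntegral.norm_integral_le_of_norm_le_const (a := T + t) (b := T)
      (fun s _ => hC s)
    simp only [zero_sub, abs_neg, sub_add_cancel_left] at h1 h2
    exact (norm_sub_le _ _).trans (add_le_add h1 h2)
  have h := tendsto_inv_atTop_zero.mul_const (C * |t| + C * |t|)
  rw [zero_mul] at h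
  refine squeeze_zero_norm' ?_ h
  filter_upwards [eventually_gt_atTop 0] with T hT
  rw [← mul_sub, norm_mul, norm_inv, Real.norm_of_nonneg hT.le]
  exact mul_le_mul_of_nonneg_left (hbound T) (inv_nonneg.2 hT.le)

end TimeAverages

section RotationSet

variable {d : ℕ} {b : (Fin d → ℝ) → (Fin d → ℝ)} {X : ℝ → (Fin d → ℝ) → (Fin d → ℝ)}
  {K : NNReal}

lemma ZdPeriodic.integrable {E : Type*} [NormedAddCommGroup E] [SecondCountableTopology E]
    {f : (Fin d → ℝ) → E} (hf : ZdPeriodic f)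
    (hc : Continuous f) (μ : Measure (Fin d → ℝ)) [IsFiniteMeasure μ] : Integrable f μ := by
  obtain ⟨C, hC⟩ := hf.exists_norm_le hc
  exact Integrable.of_bound hc.aestronglyMeasurable C (ae_of_all _ hC)

/-- Every ultrafilter limit of `X(t,x)/t` at infinity belongs to the rotation set. -/
lemma IsFlowOf.exists_mem_rotationSet_tendsto (hX : IsFlowOf b X) (hb : LipschitzWith K b)
    (hper : ZdPeriodic b) (x : Fin d → ℝ) (U : Ultrafilter ℝ) (hU : ↑U ≤ (atTop : Filter ℝ)) :
    ∃ ξ ∈ rotationSet b X, Tendsto (fun t : ℝ => t⁻¹ • X t x) U (𝓝 ξ) := by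
  obtain ⟨ν, hν, hcube, hlim⟩ := exists_limit_occupationMeasure (hX.continuous_orbit x) U hU
  refine ⟨∫ y, b y ∂ν, ⟨ν, hν, hcube, fun t ψ hψ hψper => ?_, rfl⟩, ?_⟩
  · obtain ⟨C, hC⟩ := hψper.exists_norm_le hψ
    have h1 := hlim (fun y => ψ (X t y)) (hψ.comp (hX.continuous hb t))
      (hX.zdPeriodic_comp hb hper hψper t)
    have h2 := (tendsto_average_shift_sub (hψ.comp (hX.continuous_orbit x))
      (fun s => hC (X s x)) t).mono_left hU
    have h3 := h2.add (hlim ψ hψ hψper)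
    rw [zero_add] at h3
    refine tendsto_nhds_unique h1 (h3.congr fun T => ?_)
    simp only [Function.comp_def, sub_add_cancel, add_comm _ t, hX.apply_add hb t]
  · rw [tendsto_pi_nhds]
    intro i
    have h1 := hlim (fun y => b y i) ((continuous_apply i).comp hb.continuous)
      fun κ y => congrFun (hper κ y) i
    have h2 := (tendsto_inv_atTop_zero.mul_const (x i)).mono_left hU
    have h3 := h1.add h2
    have h4 : ∫ y, b y i ∂ν = (∫ y, b y ∂ν) i :=
      (eval_integral fun j => (integrable_pi_iff.1 (hper.integrable hb.continuous ν)) j) i |>.symm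
    rw [zero_mul, add_zero, h4] at h3
    refine h3.congr fun T => ?_
    rw [hX.integral_apply hb.continuous, Pi.smul_apply, smul_eq_mul]
    ring

lemma FlowInvariant.integral_displacement_nat {μ : Measure (Fin d → ℝ)} [IsProbabilityMeasure μ]
    (hμ : FlowInvariant X μ) (hX : IsFlowOf b X) (hb : LipschitzWith K b) (hper : ZdPeriodic b)
    (t : ℝ) (i : Fin d) (n : ℕ) :
    ∫ y, (X (n * t) y i - y i) ∂μ = n * ∫ y, (X t y i - y i) ∂μ := by
  have hc (s : ℝ) : Continuous fun y => X s y i - y i := by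
    have := hX.continuous hb s
    fun_prop
  have hp (s : ℝ) : ZdPeriodic fun y => X s y i - y i := fun κ y =>
    congrFun (hX.zdPeriodic_displacement hb hper s κ y) i
  induction n with
  | zero => simp [(hX _).1]
  | succ n ih =>
    have hsplit (y : Fin d → ℝ) : X ((n + 1 : ℕ) * t) y i - y i
        = (X t (X (n * t) y) i - X (n * t) y i) + (X (n * t) y i - y i) := by
      rw [← hX.apply_add hb]
      push_cast
      ring_nf
    simp only [hsplit]
    rw [integral_add _ ((hp _).integrable (hc _) μ), ih, hμ _ _ (hc t) (hp t)]
    · push_cast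
      ring
    · exact (hX.zdPeriodic_comp hb hper (hp t) _).integrable ((hc t).comp (hX.continuous hb _)) μ

/-- The mean displacement at time one of an invariant measure is the mean of the vector field. -/
lemma FlowInvariant.integral_displacement_one {μ : Measure (Fin d → ℝ)} [IsProbabilityMeasure μ]
    (hμ : FlowInvariant X μ) (hX : IsFlowOf b X) (hb : LipschitzWith K b) (hper : ZdPeriodic b)
    (i : Fin d) : ∫ y, (X 1 y i - y i) ∂μ = ∫ y, b y i ∂μ := by
  obtain ⟨C, hC⟩ := hper.exists_norm_le hb.continuous
  have hlim : Tendsto (fun n : ℕ => ∫ y, (n + 1 : ℝ) * (X (n + 1 : ℝ)⁻¹ y i - y i) ∂μ) atTop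
      (𝓝 (∫ y, b y i ∂μ)) := by
    refine tendsto_integral_of_dominated_convergence (fun _ => C) (fun n => ?_)
      (integrable_const _) (fun n => ae_of_all _ fun y => ?_) (ae_of_all _ fun y => ?_)
    · have := hX.continuous hb (n + 1 : ℝ)⁻¹
      exact Continuous.aestronglyMeasurable (by fun_prop)
    · have hn : (0 : ℝ) < n + 1 := by positivity
      have h := (norm_le_pi_norm _ i).trans (hX.norm_displacement_le hC (n + 1 : ℝ)⁻¹ y)
      rw [abs_of_pos (inv_pos.2 hn), ← div_eq_mul_inv, le_div_iff₀ hn] at h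
      rw [norm_mul, Real.norm_of_nonneg hn.le, mul_comm]
      exact h
    · have hderiv := hasDerivAt_pi.1 ((hX y).2 0) i
      rw [(hX y).1, hasDerivAt_iff_tendsto_slope_zero] at hderiv
      have htend : Tendsto (fun n : ℕ => (n + 1 : ℝ)⁻¹) atTop (𝓝[≠] 0) := by
        refine tendsto_nhdsWithin_iff.2 ⟨?_, Eventually.of_forall fun n => ?_⟩
        · simpa using tendsto_one_div_add_atTop_nhds_zero_nat (𝕜 := ℝ)
        · simp only [mem_compl_iff, mem_singleton_iff]
          positivity
      refine (hderiv.comp htend).congr fun n => ?_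
      simp [(hX y).1]
  refine tendsto_nhds_unique (tendsto_const_nhds.congr fun n => ?_) hlim
  have h := hμ.integral_displacement_nat hX hb hper (n + 1 : ℝ)⁻¹ i (n + 1)
  have hn : (n + 1 : ℝ) ≠ 0 := by positivity
  push_cast at h
  rw [mul_inv_cancel₀ hn] at h
  rw [integral_const_mul, h]

lemma FlowInvariant.integral_eq_of_tendsto {μ : Measure (Fin d → ℝ)} [IsProbabilityMeasure μ]
    (hμ : FlowInvariant X μ) (hX : IsFlowOf b X) (hb : LipschitzWith K b) (hper : ZdPeriodic b)
    {ζ : Fin d → ℝ}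
    (hζ : ∀ x : Fin d → ℝ, Tendsto (fun t : ℝ => t⁻¹ • X t x) atTop (𝓝 ζ)) :
    ∫ y, b y ∂μ = ζ := by
  obtain ⟨C, hC⟩ := hper.exists_norm_le hb.continuous
  ext i
  rw [eval_integral fun j => (integrable_pi_iff.1 (hper.integrable hb.continuous μ)) j,
    ← hμ.integral_displacement_one hX hb hper i]
  have hcast : Tendsto (fun n : ℕ => (n + 1 : ℝ)) atTop atTop :=
    tendsto_atTop_add_const_right _ _ tendsto_natCast_atTop_atTop
  have hlim : Tendsto (fun n : ℕ => ∫ y, (n + 1 : ℝ)⁻¹ * (X (n + 1) y i - y i) ∂μ) atTop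
      (𝓝 (∫ _, ζ i ∂μ)) := by
    refine tendsto_integral_of_dominated_convergence (fun _ => C) (fun n => ?_)
      (integrable_const _) (fun n => ae_of_all _ fun y => ?_) (ae_of_all _ fun y => ?_)
    · have := hX.continuous hb (n + 1)
      exact Continuous.aestronglyMeasurable (by fun_prop)
    · have hn : (0 : ℝ) < n + 1 := by positivity
      have h := (norm_le_pi_norm _ i).trans (hX.norm_displacement_le hC (n + 1) y)
      rw [abs_of_pos hn] at h
      rw [norm_mul, norm_inv, Real.norm_of_nonneg hn.le, inv_mul_le_iff₀ hn, mul_comm]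
      exact h
    · have h1 := (tendsto_pi_nhds.1 (hζ y) i).comp hcast
      have h2 := (tendsto_inv_atTop_zero.mul_const (y i)).comp hcast
      have h3 := h1.sub h2
      rw [zero_mul, sub_zero] at h3
      refine h3.congr fun n => ?_
      simp only [Function.comp_apply, Pi.smul_apply, smul_eq_mul, mul_sub]
  rw [integral_const, probReal_univ, one_smul] at hlim
  refine tendsto_nhds_unique (tendsto_const_nhds.congr fun n => ?_) hlim
  have h := hμ.integral_displacement_nat hX hb hper 1 i (n + 1)
  have hn : (n + 1 : ℝ) ≠ 0 := by positivity
  rw [mul_one] at h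
  push_cast at h
  rw [integral_const_mul, h, inv_mul_cancel_left₀ hn]

end RotationSet

/-- For `b ∈ C¹_♯(Y_d)^d` with flow `X` and `ζ ∈ ℝ^d`, Herman's rotation set
`C_b` equals `{ζ}` iff `X(t,x)/t → ζ` as `t → ∞` for every `x ∈ ℝ^d`. -/
theorem rotationSet_eq_singleton_iff_flow_asymptotics {d : ℕ} (hd : 1 ≤ d)
    (b : (Fin d → ℝ) → (Fin d → ℝ)) (hb : ContDiff ℝ 1 b) (hbper : ZdPeriodic b)
    (X : ℝ → (Fin d → ℝ) → (Fin d → ℝ)) (hX : IsFlowOf b X) (ζ : Fin d → ℝ) :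
    rotationSet b X = {ζ} ↔
      ∀ x : Fin d → ℝ, Tendsto (fun t : ℝ => t⁻¹ • X t x) atTop (nhds ζ) := by
  obtain ⟨K, hK⟩ := hbper.exists_lipschitzWith hb
  constructor
  · intro h x
    rw [tendsto_iff_ultrafilter]
    intro U hU
    obtain ⟨ξ, hξ, hlim⟩ := hX.exists_mem_rotationSet_tendsto hK hbper x U hU
    rw [h, mem_singleton_iff] at hξ
    rwa [hξ] at hlim
  · intro h
    refine eq_singleton_iff_nonempty_unique_mem.2 ⟨?_, ?_⟩
    · obtain ⟨ξ, hξ, -⟩ := hX.exists_mem_rotationSet_tendsto hK hbper 0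
        (Ultrafilter.of atTop) (Ultrafilter.of_le _)
      exact ⟨ξ, hξ⟩
    · rintro ξ ⟨μ, hμ, -, hinv, rfl⟩
      exact hinv.integral_eq_of_tendsto hX hK hbper h
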